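/- arXiv:1507.05388 — 10 statements merged into one kernel-verified Lean document; each statement's English description precedes it below -/
import Mathlib

section
/- Let P be a dual-Horn program and t an atom with t ∉ at(P). Then (1) the sets E_i form an increasing chain E_0 ⊆ E_1 ⊆ ⋯ ⊆ at(P) ∪ {t}; and (2) the set (at(P) ∪ {t}) \ ⋃_{i≥0} E_i is an inclusion-maximal model of P[t] among subsets of at(P) ∪ {t}. -/
open Classical

noncomputable section

/-- A rule of a disjunctive logic program: head, positive body, negative body. -/
structure Rule (A : Type*) where
  head : Finset A
  bodyP : Finset A
  bodyN : Finset A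
  deriving DecidableEq

/-- A program is a finite set of rules. -/
abbrev Program (A : Type*) := Finset (Rule A)

variable {A : Type*} [DecidableEq A]

/-- The atoms occurring in a program. -/
def atoms (P : Program A) : Finset A := P.sup (fun r => r.head ∪ r.bodyP ∪ r.bodyN)

/-- An interpretation `I` satisfies a rule `r` iff `(H(r) ∪ B⁻(r)) ∩ I ≠ ∅` or `B⁺(r) \ I ≠ ∅`. -/
def satR (I : Set A) (r : Rule A) : Prop :=
  (∃ a ∈ r.head ∪ r.bodyN, a ∈ I) ∨ (∃ a ∈ r.bodyP, a ∉ I)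

/-- `I` is a model of `P` iff it satisfies every rule of `P`. -/
def isModel (I : Set A) (P : Program A) : Prop := ∀ r ∈ P, satR I r

/-- The Gelfond-Lifschitz reduct `P^I`. -/
def reduct (P : Program A) (I : Set A) : Program A :=
  (P.filter (fun r => ∀ a ∈ r.bodyN, a ∉ I)).image (fun r => ⟨r.head, r.bodyP, ∅⟩)

/-- `I` is an inclusion-minimal model of `P`. -/
def isMinModel (I : Set A) (P : Program A) : Prop :=
  isModel I P ∧ ∀ J ⊆ I, isModel J P → J = I

/-- `I` is an answer set of `P` iff `I` is a minimal model of the reduct `P^I`. -/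
def isAnswerSet (I : Set A) (P : Program A) : Prop := isMinModel I (reduct P I)

/-- The collection of answer sets of `P`. -/
def AS (P : Program A) : Set (Set A) := {M | isAnswerSet M P}

/-- Dual-Horn: every rule has at most one positive body atom and empty negative body. -/
def dualHorn (P : Program A) : Prop := ∀ r ∈ P, r.bodyP.card ≤ 1 ∧ r.bodyN = ∅

/-- Dual-normal: every rule is a constraint or has at most one positive body atom. -/
def dualNormal (P : Program A) : Prop := ∀ r ∈ P, r.head = ∅ ∨ r.bodyP.card ≤ 1

/-- Normal: every rule has at most one head atom. -/
def normal (P : Program A) : Prop := ∀ r ∈ P, r.head.card ≤ 1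

/-- The proper rules (non-constraints) of `P`. -/
def properPart (P : Program A) : Program A := P.filter (fun r => r.head ≠ ∅)

/-- The constraints of `P`. -/
def constraintPart (P : Program A) : Program A := P.filter (fun r => r.head = ∅)

/-- `P[t]`: replace each rule with empty positive body by one whose positive body is `{t}`. -/
def progT (P : Program A) (t : A) : Program A :=
  P.image (fun r => if r.bodyP = ∅ then ⟨r.head, {t}, r.bodyN⟩ else r)

/-- The elimination sets `E_i` computed from `P[t]` (for `P` dual-Horn). -/
def E (P : Program A) (t : A) : ℕ → Set A
  | 0 => ∅
  | (i+1) => {b | ∃ r ∈ progT P t, r.bodyP = {b} ∧ ↑r.head ⊆ E P t i}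

/-- The program `P_{M,m}`. -/
def pmm (P : Program A) (M : Set A) (m : A) : Program A :=
  reduct (properPart P) M ∪
    ((atoms P).filter (fun b => b ∉ M)).image (fun b => ⟨∅, {b}, ∅⟩) ∪
    {⟨∅, {m}, ∅⟩}

theorem progT_rule (P : Program A) (t : A) (hP : dualHorn P) (r : Rule A) (hr : r ∈ progT P t) :
    (∃ b, r.bodyP = {b} ∧ b ∈ (↑(atoms P) ∪ {t} : Set A)) ∧ r.bodyN = ∅ ∧ r.head ⊆ atoms P := by
  unfold progT at hr
  rw [Finset.mem_image] at hr
  obtain ⟨q, hq, rfl⟩ := hr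
  have hsub : q.head ∪ q.bodyP ∪ q.bodyN ⊆ atoms P :=
    Finset.le_sup (f := fun r : Rule A => r.head ∪ r.bodyP ∪ r.bodyN) hq
  obtain ⟨hc, hn⟩ := hP q hq
  have hh : q.head ⊆ atoms P := fun a ha => hsub (by simp [ha])
  split_ifs with h
  · exact ⟨⟨t, rfl, by simp⟩, hn, hh⟩
  · refine ⟨?_, hn, hh⟩
    have h1 : q.bodyP.card = 1 := by
      have := Finset.card_pos.mpr (Finset.nonempty_iff_ne_empty.mpr h)
      omega
    obtain ⟨b, hb⟩ := Finset.card_eq_one.mp h1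
    exact ⟨b, hb, Or.inl (hsub (by simp [hb]))⟩

theorem E_step (P : Program A) (t : A) (i : ℕ) : E P t i ⊆ E P t (i + 1) := by
  induction i with
  | zero => intro x hx; exact absurd hx (by simp [E])
  | succ k ih =>
    rintro b ⟨r, hr, hb, hh⟩
    exact ⟨r, hr, hb, hh.trans ih⟩

/-- For a dual-Horn program `P` and fresh atom `t`, the sets `E_i` form an
increasing chain inside `at(P) ∪ {t}`, and `(at(P) ∪ {t}) \ ⋃ᵢ E_i` is an inclusion-maximal
model of `P[t]` among subsets of `at(P) ∪ {t}`. -/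
theorem dualHorn_E_chain_and_maximal_model (P : Program A) (t : A)
    (hP : dualHorn P) (ht : t ∉ atoms P) :
    (∀ i : ℕ, E P t i ⊆ E P t (i + 1)) ∧
    (∀ i : ℕ, E P t i ⊆ (↑(atoms P) ∪ {t} : Set A)) ∧
    Maximal (fun N : Set A => N ⊆ (↑(atoms P) ∪ {t} : Set A) ∧ isModel N (progT P t))
      ((↑(atoms P) ∪ {t} : Set A) \ ⋃ i, E P t i) := by
  have hmono : Monotone (E P t) := monotone_nat_of_le_succ (E_step P t)
  refine ⟨E_step P t, ?_, ⟨Set.diff_subset, ?_⟩, ?_⟩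
  · intro i
    cases i with
    | zero => intro x hx; exact absurd hx (by simp [E])
    | succ k =>
      rintro b ⟨r, hr, hb, -⟩
      obtain ⟨⟨c, hc, hc2⟩, -, -⟩ := progT_rule P t hP r hr
      rw [hc, Finset.singleton_inj] at hb
      exact hb ▸ hc2
  · intro r hr
    obtain ⟨⟨c, hc, hc2⟩, hn, hh⟩ := progT_rule P t hP r hr
    by_cases hsub : ∀ a ∈ r.head, ∃ i, a ∈ E P t i
    · right
      refine ⟨c, by simp [hc], fun hcn => hcn.2 ?_⟩
      choose! f hf using hsub
      refine Set.mem_iUnion.mpr ⟨r.head.sup f + 1, r, hr, hc, fun a ha => ?_⟩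
      exact hmono (Finset.le_sup (f := f) (Finset.mem_coe.mp ha)) (hf a ha)
    · left
      push Not at hsub
      obtain ⟨a, ha, hna⟩ := hsub
      refine ⟨a, Finset.mem_union_left _ ha, Or.inl (hh ha), fun h => ?_⟩
      obtain ⟨i, hi⟩ := Set.mem_iUnion.mp h
      exact hna i hi
  · rintro N ⟨hN, hM⟩ - x hx
    have key : ∀ i, ∀ y ∈ E P t i, y ∉ N := by
      intro i
      induction i with
      | zero => intro y hy; exact absurd hy (by simp [E])
      | succ k ih =>
        rintro b ⟨r, hr, hb, hh⟩ hbN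
        obtain ⟨-, hn, -⟩ := progT_rule P t hP r hr
        rcases hM r hr with ⟨a, ha, haN⟩ | ⟨a, ha, haN⟩
        · rw [hn, Finset.union_empty] at ha
          exact ih a (hh ha) haN
        · rw [hb, Finset.mem_singleton] at ha
          exact haN (ha ▸ hbN)
    refine ⟨hN hx, fun h => ?_⟩
    obtain ⟨i, hi⟩ := Set.mem_iUnion.mp h
    exact key i x hi hx
end
end

section
/- Let P be a dual-Horn program and t an atom with t ∉ at(P). Then (1) for every set M ⊆ at(P), M is a model of P if and only if M ∪ {t} is a model of P[t]; and (2) P has a model contained in at(P) if and only if t ∉ ⋃_{i≥0} E_i. -/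
open Classical

noncomputable section

variable {A : Type*} [DecidableEq A]

theorem mem_atoms_of {P : Program A} {r : Rule A} (hr : r ∈ P) {a : A}
    (ha : a ∈ r.head ∪ r.bodyP ∪ r.bodyN) : a ∈ atoms P := by
  have h : r.head ∪ r.bodyP ∪ r.bodyN ≤ atoms P :=
    Finset.le_sup (f := fun r : Rule A => r.head ∪ r.bodyP ∪ r.bodyN) hr
  exact h ha

theorem mem_progT {P : Program A} {t : A} {r' : Rule A} :
    r' ∈ progT P t ↔
      ∃ r ∈ P, (if r.bodyP = ∅ then (⟨r.head, {t}, r.bodyN⟩ : Rule A) else r) = r' := by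
  unfold progT
  exact Finset.mem_image

theorem E_succ {P : Program A} {t : A} {i : ℕ} {b : A} :
    b ∈ E P t (i + 1) ↔ ∃ r ∈ progT P t, r.bodyP = {b} ∧ ↑r.head ⊆ E P t i := Iff.rfl

theorem E_mono (P : Program A) (t : A) : Monotone (E P t) := by
  apply monotone_nat_of_le_succ
  intro i
  induction i with
  | zero => exact Set.empty_subset _
  | succ k ih =>
    intro b hb
    obtain ⟨r, hr, h1, h2⟩ := E_succ.1 hb
    exact E_succ.2 ⟨r, hr, h1, h2.trans ih⟩

theorem mem_iUnion_E {P : Program A} {t : A} {r : Rule A} {b : A} (hr : r ∈ progT P t)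
    (hb : r.bodyP = {b}) (hh : ∀ a ∈ r.head, a ∈ ⋃ i, E P t i) : b ∈ ⋃ i, E P t i := by
  have hi : ∃ i, (↑r.head : Set A) ⊆ E P t i := by
    choose! f hf using fun a ha => Set.mem_iUnion.1 (hh a ha)
    exact ⟨r.head.sup f, fun a ha => E_mono P t (Finset.le_sup (f := f) ha) (hf a ha)⟩
  obtain ⟨i, hi⟩ := hi
  exact Set.mem_iUnion.2 ⟨i + 1, E_succ.2 ⟨r, hr, hb, hi⟩⟩

theorem model_iff (P : Program A) (t : A) (ht : t ∉ atoms P) (M : Set A)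
    (hM : M ⊆ ↑(atoms P)) : isModel M P ↔ isModel (M ∪ {t}) (progT P t) := by
  have key : ∀ r ∈ P, (satR M r ↔
      satR (M ∪ {t}) (if r.bodyP = ∅ then (⟨r.head, {t}, r.bodyN⟩ : Rule A) else r)) := by
    intro r hr
    have h1 : ∀ a ∈ r.head ∪ r.bodyN, (a ∈ M ∪ {t} ↔ a ∈ M) := by
      intro a ha
      have : a ≠ t := by
        rintro rfl
        exact ht (mem_atoms_of hr (by simp only [Finset.mem_union] at *; tauto))
      simp [this]
    have h2 : ∀ a ∈ r.bodyP, (a ∈ M ∪ {t} ↔ a ∈ M) := by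
      intro a ha
      have : a ≠ t := by
        rintro rfl
        exact ht (mem_atoms_of hr (by simp only [Finset.mem_union] at *; tauto))
      simp [this]
    have e1 : (∃ a ∈ r.head ∪ r.bodyN, a ∈ M ∪ {t}) ↔ (∃ a ∈ r.head ∪ r.bodyN, a ∈ M) :=
      exists_congr fun a => and_congr_right fun ha => h1 a ha
    have e2 : (∃ a ∈ r.bodyP, a ∉ M ∪ {t}) ↔ (∃ a ∈ r.bodyP, a ∉ M) :=
      exists_congr fun a => and_congr_right fun ha => not_congr (h2 a ha)
    split_ifs with h
    · unfold satR
      rw [e1]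
      simp [h]
    · unfold satR
      rw [e1, e2]
  constructor
  · intro h r' hr'
    obtain ⟨r, hr, rfl⟩ := mem_progT.1 hr'
    exact (key r hr).1 (h r hr)
  · intro h r hr
    exact (key r hr).2 (h _ (mem_progT.2 ⟨r, hr, rfl⟩))

/-- For a dual-Horn program `P` and fresh atom `t`:
(1) for every `M ⊆ at(P)`, `M` is a model of `P` iff `M ∪ {t}` is a model of `P[t]`;
(2) `P` has a model contained in `at(P)` iff `t ∉ ⋃ᵢ E_i`. -/
theorem dualHorn_progT_models_and_consistency (P : Program A) (t : A)
    (hP : dualHorn P) (ht : t ∉ atoms P) :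
    (∀ M : Set A, M ⊆ ↑(atoms P) → (isModel M P ↔ isModel (M ∪ {t}) (progT P t))) ∧
    ((∃ M : Set A, M ⊆ ↑(atoms P) ∧ isModel M P) ↔ t ∉ ⋃ i, E P t i) := by
  refine ⟨model_iff P t ht, ?_, ?_⟩
  · rintro ⟨M, hM, hmod⟩ hmem
    have hmod' := (model_iff P t ht M hM).1 hmod
    have hdis : ∀ i, ∀ b ∈ E P t i, b ∉ M ∪ {t} := by
      intro i
      induction i with
      | zero => intro b hb; exact hb.elim
      | succ k ih =>
        intro b hb
        obtain ⟨r', hr', h1, h2⟩ := E_succ.1 hb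
        have hN : r'.bodyN = ∅ := by
          obtain ⟨r, hr, rfl⟩ := mem_progT.1 hr'
          have := (hP r hr).2
          split_ifs <;> exact this
        rcases hmod' r' hr' with ⟨a, ha, haM⟩ | ⟨a, ha, haM⟩
        · rw [hN, Finset.union_empty] at ha
          exact absurd haM (ih a (h2 ha))
        · rw [h1, Finset.mem_singleton] at ha
          exact ha ▸ haM
    obtain ⟨i, hi⟩ := Set.mem_iUnion.1 hmem
    exact hdis i t hi (Or.inr rfl)
  · intro hmem
    refine ⟨{a | a ∈ atoms P ∧ a ∉ ⋃ i, E P t i}, fun a ha => ha.1, ?_⟩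
    intro r hr
    by_contra hns
    have hhead : ∀ a ∈ r.head, a ∈ ⋃ i, E P t i := by
      intro a ha
      by_contra hna
      exact hns (Or.inl ⟨a, Finset.mem_union_left _ ha,
        mem_atoms_of hr (Finset.mem_union_left _ (Finset.mem_union_left _ ha)), hna⟩)
    have hin := mem_progT.2 ⟨r, hr, (rfl : _ = (if r.bodyP = ∅ then
      (⟨r.head, {t}, r.bodyN⟩ : Rule A) else r))⟩
    by_cases h : r.bodyP = ∅
    · rw [if_pos h] at hin
      exact hmem (mem_iUnion_E hin rfl hhead)
    · rw [if_neg h] at hin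
      have hc : r.bodyP.card = 1 :=
        le_antisymm (hP r hr).1 (Finset.card_pos.2 (Finset.nonempty_iff_ne_empty.2 h))
      obtain ⟨b, hb⟩ := Finset.card_eq_one.1 hc
      exact hns (Or.inr ⟨b, by simp [hb], fun hbM => hbM.2 (mem_iUnion_E hin hb hhead)⟩)
end
end

section
/- For any program P and any set M of atoms, the following three statements are equivalent: (1) M is an answer set of P; (2) M is a model of P and an inclusion-minimal model of the reduct (P_r)^M; (3) M is a model of P_c and M is an answer set of P_r. -/
open Classical

noncomputable section

variable {A : Type*} [DecidableEq A]

theorem isModel_reduct_iff (P : Program A) (I J : Set A) :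
    isModel J (reduct P I) ↔ ∀ r ∈ P, (∀ a ∈ r.bodyN, a ∉ I) →
      ((∃ a ∈ r.head, a ∈ J) ∨ ∃ a ∈ r.bodyP, a ∉ J) := by
  constructor
  · intro h r hr hN
    have h1 := h ⟨r.head, r.bodyP, ∅⟩
      (Finset.mem_image.2 ⟨r, Finset.mem_filter.2 ⟨hr, hN⟩, rfl⟩)
    simpa [satR] using h1
  · intro h r hr
    obtain ⟨r', hr', rfl⟩ := Finset.mem_image.1 hr
    obtain ⟨h1, h2⟩ := Finset.mem_filter.1 hr'
    simpa [satR] using h r' h1 h2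

theorem isModel_reduct_self (P : Program A) (M : Set A) :
    isModel M (reduct P M) ↔ isModel M P := by
  rw [isModel_reduct_iff]
  refine forall₂_congr fun r _ => ?_
  simp only [satR, Finset.mem_union]
  grind

theorem isModel_split (P : Program A) (M : Set A) :
    isModel M P ↔ isModel M (constraintPart P) ∧ isModel M (properPart P) := by
  simp only [isModel, constraintPart, properPart, Finset.mem_filter]
  grind

theorem isModel_reduct_of_subset (P : Program A) (M J : Set A) (hJ : J ⊆ M)
    (hM : isModel M P) :
    isModel J (reduct P M) ↔ isModel J (reduct (properPart P) M) := by
  rw [← isModel_reduct_self, isModel_reduct_iff] at hM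
  rw [isModel_reduct_iff, isModel_reduct_iff]
  constructor
  · intro h r hr
    exact h r (Finset.mem_filter.1 hr).1
  · intro h r hr hN
    by_cases hh : r.head = ∅
    · rcases hM r hr hN with ⟨a, ha, _⟩ | ⟨a, ha, haM⟩
      · simp [hh] at ha
      · exact Or.inr ⟨a, ha, fun h' => haM (hJ h')⟩
    · exact h r (Finset.mem_filter.2 ⟨hr, hh⟩) hN

theorem isAnswerSet_iff_aux (P : Program A) (M : Set A) :
    isAnswerSet M P ↔ (isModel M P ∧ isMinModel M (reduct (properPart P) M)) := by
  unfold isAnswerSet isMinModel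
  rw [isModel_reduct_self, isModel_reduct_self]
  constructor
  · rintro ⟨h1, h2⟩
    exact ⟨h1, ((isModel_split P M).1 h1).2, fun J hJ h =>
      h2 J hJ ((isModel_reduct_of_subset P M J hJ h1).2 h)⟩
  · rintro ⟨h1, _, h2⟩
    exact ⟨h1, fun J hJ h => h2 J hJ ((isModel_reduct_of_subset P M J hJ h1).1 h)⟩

/-- For any program `P` and any set `M` of atoms, the following are equivalent:
(1) `M` is an answer set of `P`;
(2) `M` is a model of `P` and an inclusion-minimal model of `(P_r)^M`;
(3) `M` is a model of `P_c` and an answer set of `P_r`. -/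
theorem answerSet_characterizations (P : Program A) (M : Set A) :
    (isAnswerSet M P ↔ (isModel M P ∧ isMinModel M (reduct (properPart P) M))) ∧
    (isAnswerSet M P ↔ (isModel M (constraintPart P) ∧ isAnswerSet M (properPart P))) := by
  refine ⟨isAnswerSet_iff_aux P M, (isAnswerSet_iff_aux P M).trans ?_⟩
  rw [isModel_split]
  constructor
  · rintro ⟨⟨h1, _⟩, h2⟩
    exact ⟨h1, h2⟩
  · rintro ⟨h1, h2⟩
    exact ⟨⟨h1, (isModel_reduct_self _ _).1 h2.1⟩, h2⟩
end
end

section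
/- Let P be a dual-normal program. Then AS(P) = {M ∩ at(P) : M is a model of the propositional formula F(P)}. -/
open Classical

noncomputable section

variable {A : Type*} [DecidableEq A]

/- Propositional variables of `F(P)`: either an original atom `a ∈ at(P)` (`Sum.inl a`),
or a fresh variable `a_m^i` represented as `Sum.inr (some a, m, i)`, with `t_m^i`
represented as `Sum.inr (none, m, i)`. -/

/-- `P_r ⊓ B`: the proper rules of `P` whose positive body equals `B`. -/
def sqcap (P : Program A) (B : Finset A) : Program A :=
  (properPart P).filter (fun r => r.bodyP = B)

/-- Satisfaction of `C_m^i(R)` by an assignment `I`. -/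
def satC (I : Set (A ⊕ (Option A × A × ℕ))) (m : A) (i : ℕ) (R : Program A) : Prop :=
  ∀ r ∈ R, (∃ a ∈ r.head, Sum.inr (some a, m, i - 1) ∈ I) ∨ (∃ a ∈ r.bodyN, Sum.inl a ∈ I)

/-- Satisfaction of `F_m^0` by an assignment `I`. -/
def satF0 (P : Program A) (I : Set (A ⊕ (Option A × A × ℕ))) (m : A) : Prop :=
  Sum.inr (some m, m, 0) ∉ I ∧ Sum.inr ((none : Option A), m, 0) ∈ I ∧
  ∀ a ∈ atoms P, a ≠ m → (Sum.inr (some a, m, 0) ∈ I ↔ Sum.inl a ∈ I)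

/-- Satisfaction of `F_m^i` (for `1 ≤ i ≤ p`) by an assignment `I`. -/
def satFi (P : Program A) (I : Set (A ⊕ (Option A × A × ℕ))) (m : A) (i : ℕ) : Prop :=
  (∀ a ∈ atoms P, a ≠ m →
    (Sum.inr (some a, m, i) ∈ I ↔
      (Sum.inr (some a, m, i - 1) ∈ I ∧ satC I m i (sqcap P {a})))) ∧
  (Sum.inr ((none : Option A), m, i) ∈ I ↔
    (Sum.inr ((none : Option A), m, i - 1) ∈ I ∧ satC I m i (sqcap P ∅)))

/-- Satisfaction of `F_Mod` by an assignment `I`. -/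
def satFMod (P : Program A) (I : Set (A ⊕ (Option A × A × ℕ))) : Prop :=
  ∀ r ∈ P, (∃ a ∈ r.head ∪ r.bodyN, Sum.inl a ∈ I) ∨ (∃ a ∈ r.bodyP, Sum.inl a ∉ I)

/-- Satisfaction of the whole formula `F(P)` by an assignment `I` (a set of variables),
with `p = |at(P)|`. -/
def satFP (P : Program A) (I : Set (A ⊕ (Option A × A × ℕ))) : Prop :=
  satFMod P I ∧
  ∀ a ∈ atoms P, Sum.inl a ∈ I →
    (satF0 P I a ∧
     (∀ i : ℕ, 1 ≤ i → i ≤ (atoms P).card → satFi P I a i) ∧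
     Sum.inr ((none : Option A), a, (atoms P).card) ∉ I)

/-- Iterated elimination, starting from `M \\ {m}`. -/
def elimK (P : Program A) (M : Set A) (m : A) : ℕ → Set A
  | 0 => {a | a ∈ M ∧ a ≠ m}
  | (i+1) => {a | a ∈ elimK P M m i ∧ ∀ r ∈ sqcap P {a},
      (∃ h ∈ r.head, h ∈ elimK P M m i) ∨ (∃ b ∈ r.bodyN, b ∈ M)}

/-- Truth of `t_m^i`. -/
def elimT (P : Program A) (M : Set A) (m : A) : ℕ → Prop
  | 0 => True
  | (i+1) => elimT P M m i ∧ ∀ r ∈ sqcap P ∅,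
      (∃ h ∈ r.head, h ∈ elimK P M m i) ∨ (∃ b ∈ r.bodyN, b ∈ M)

/-- The assignment built from `M`. -/
def elimI (P : Program A) (M : Set A) : Set (A ⊕ (Option A × A × ℕ)) :=
  {x | match x with
    | Sum.inl a => a ∈ M
    | Sum.inr (some a, m, i) => a ∈ elimK P M m i
    | Sum.inr (none, m, i) => elimT P M m i}

lemma elimK_sub (P : Program A) (M : Set A) (m : A) (i : ℕ) :
    elimK P M m i ⊆ {a | a ∈ M ∧ a ≠ m} := by
  induction i with
  | zero => exact subset_rfl
  | succ i ih => exact fun a ha => ih ha.1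

lemma elimT_mono (P : Program A) (M : Set A) (m : A) {i j : ℕ} (h : i ≤ j)
    (hj : elimT P M m j) : elimT P M m i := by
  induction j, h using Nat.le_induction with
  | base => exact hj
  | succ j _ ih => exact ih hj.1

lemma mem_atoms {P : Program A} {r : Rule A} (hr : r ∈ P) {a : A}
    (ha : a ∈ r.head ∨ a ∈ r.bodyP ∨ a ∈ r.bodyN) : a ∈ atoms P := by
  have h : r.head ∪ r.bodyP ∪ r.bodyN ⊆ atoms P :=
    Finset.le_sup (f := fun r : Rule A => r.head ∪ r.bodyP ∪ r.bodyN) hr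
  apply h
  simp only [Finset.mem_union]
  tauto

lemma isModel_reduct (P : Program A) (M J : Set A) :
    isModel J (reduct P M) ↔ ∀ r ∈ P, (∀ b ∈ r.bodyN, b ∉ M) →
      (∃ a ∈ r.head, a ∈ J) ∨ ∃ a ∈ r.bodyP, a ∉ J := by
  simp only [isModel, reduct, satR, Finset.mem_image, Finset.mem_filter]
  constructor
  · intro h r hr hb
    have := h ⟨r.head, r.bodyP, ∅⟩ ⟨r, ⟨hr, hb⟩, rfl⟩
    simpa using this
  · rintro h _ ⟨r, ⟨hr, hb⟩, rfl⟩
    simpa using h r hr hb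

lemma elimK_stat (P : Program A) (M : Set A) (m : A) (hM : M ⊆ ↑(atoms P)) (hm : m ∈ M) :
    ∃ k < (atoms P).card, elimK P M m k = elimK P M m (k+1) := by
  by_contra! hcon
  have hfin : ∀ i, (elimK P M m i).Finite := fun i =>
    (atoms P).finite_toSet.subset (fun a ha => hM (elimK_sub P M m i ha).1)
  have key : ∀ k ≤ (atoms P).card, (elimK P M m k).ncard + k < (atoms P).card := by
    intro k
    induction k with
    | zero =>
      intro _
      have : elimK P M m 0 ⊂ ↑(atoms P) := by
        refine ⟨fun a ha => hM ha.1, fun h => ?_⟩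
        exact (h (hM hm)).2 rfl
      have := Set.ncard_lt_ncard this (atoms P).finite_toSet
      simpa using this
    | succ k ih =>
      intro hk
      have h1 := ih (by omega)
      have hsub : elimK P M m (k+1) ⊆ elimK P M m k := fun a ha => ha.1
      have := Set.ncard_lt_ncard (hsub.ssubset_of_ne (hcon k (by omega)).symm) (hfin k)
      omega
  have := key _ le_rfl
  omega

/-- For a dual-normal program `P`,
`AS(P) = { M ∩ at(P) : M a model of F(P) }`. -/
theorem dualNormal_AS_eq_models_FP (P : Program A) (hP : dualNormal P) :
    AS P = {M : Set A | ∃ I : Set (A ⊕ (Option A × A × ℕ)),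
      satFP P I ∧ M = {a : A | a ∈ atoms P ∧ Sum.inl a ∈ I}} := by
  ext M
  simp only [AS, Set.mem_setOf_eq, isAnswerSet, isMinModel]
  constructor
  · rintro ⟨hmod, hmin⟩
    rw [isModel_reduct] at hmod
    have hMat : M ⊆ ↑(atoms P) := by
      have := hmin (M ∩ ↑(atoms P)) Set.inter_subset_left (by
        rw [isModel_reduct]
        intro r hr hb
        rcases hmod r hr hb with ⟨a, ha, haM⟩ | ⟨a, ha, haM⟩
        · exact Or.inl ⟨a, ha, haM, mem_atoms hr (Or.inl ha)⟩
        · exact Or.inr ⟨a, ha, fun h => haM h.1⟩)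
      rw [← this]
      exact Set.inter_subset_right
    refine ⟨elimI P M, ⟨?_, ?_⟩, ?_⟩
    · intro r hr
      by_cases hb : ∀ b ∈ r.bodyN, b ∉ M
      · rcases hmod r hr hb with ⟨a, ha, haM⟩ | h
        · exact Or.inl ⟨a, Finset.mem_union_left _ ha, haM⟩
        · exact Or.inr h
      · push Not at hb
        obtain ⟨b, hb, hbM⟩ := hb
        exact Or.inl ⟨b, Finset.mem_union_right _ hb, hbM⟩
    · intro m _ hm
      have hm : m ∈ M := hm
      refine ⟨⟨fun h => h.2 rfl, trivial, fun a _ hne => ⟨fun h => h.1, fun h => ⟨h, hne⟩⟩⟩, ?_, ?_⟩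
      · intro i hi _
        obtain ⟨j, rfl⟩ : ∃ j, i = j + 1 := ⟨i - 1, by omega⟩
        exact ⟨fun a _ _ => Iff.rfl, Iff.rfl⟩
      · intro hT
        have hT : elimT P M m (atoms P).card := hT
        obtain ⟨k, hk, hst⟩ := elimK_stat P M m hMat hm
        have hKM : elimK P M m k ⊆ M := fun a ha => (elimK_sub P M m k ha).1
        have heq := hmin (elimK P M m k) hKM (by
          rw [isModel_reduct]
          intro r hr hb
          by_cases hh : r.head = ∅
          · rcases hmod r hr hb with ⟨a, ha, _⟩ | ⟨a, ha, haM⟩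
            · simp [hh] at ha
            · exact Or.inr ⟨a, ha, fun h => haM (hKM h)⟩
          · have hc := (hP r hr).resolve_left hh
            rcases Nat.le_one_iff_eq_zero_or_eq_one.mp hc with h0 | h1
            · have h0 := Finset.card_eq_zero.mp h0
              have := (elimT_mono P M m (Nat.succ_le_of_lt hk) hT).2 r
                (by simp [sqcap, properPart, hr, hh, h0])
              rcases this with h | ⟨b, hb1, hb2⟩
              · exact Or.inl h
              · exact absurd hb2 (hb b hb1)
            · obtain ⟨a, ha⟩ := Finset.card_eq_one.mp h1
              by_cases haK : a ∈ elimK P M m k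
              · have h2 := haK
                rw [hst] at h2
                rcases h2.2 r (by simp [sqcap, properPart, hr, hh, ha]) with h | ⟨b, hb1, hb2⟩
                · exact Or.inl h
                · exact absurd hb2 (hb b hb1)
              · exact Or.inr ⟨a, by simp [ha], haK⟩)
        rw [← heq] at hm
        exact (elimK_sub P M m k hm).2 rfl
    · ext a
      exact ⟨fun h => ⟨hMat h, h⟩, fun h => h.2⟩
  · rintro ⟨I, ⟨hmod, hF⟩, rfl⟩
    set M : Set A := {a : A | a ∈ atoms P ∧ Sum.inl a ∈ I} with hM
    constructor
    · rw [isModel_reduct]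
      intro r hr hb
      rcases hmod r hr with ⟨a, ha, haI⟩ | ⟨a, ha, haI⟩
      · rcases Finset.mem_union.mp ha with ha | ha
        · exact Or.inl ⟨a, ha, mem_atoms hr (Or.inl ha), haI⟩
        · exact absurd ⟨mem_atoms hr (Or.inr (Or.inr ha)), haI⟩ (hb a ha)
      · exact Or.inr ⟨a, ha, fun h => haI h.2⟩
    · intro J hJM hJ
      rw [isModel_reduct] at hJ
      by_contra hne
      obtain ⟨m, hmM, hmJ⟩ : ∃ m ∈ M, m ∉ J := by
        by_contra! h
        exact hne (Set.Subset.antisymm hJM h)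
      obtain ⟨⟨_, ht0, h0⟩, hi, ht⟩ := hF m hmM.1 hmM.2
      have key : ∀ i ≤ (atoms P).card, (∀ a ∈ J, Sum.inr (some a, m, i) ∈ I) ∧
          Sum.inr ((none : Option A), m, i) ∈ I := by
        intro i
        induction i with
        | zero =>
          intro _
          refine ⟨fun a ha => (h0 a (hJM ha).1 ?_).2 (hJM ha).2, ht0⟩
          rintro rfl
          exact hmJ ha
        | succ i ih =>
          intro hle
          obtain ⟨ih1, ih2⟩ := ih (by omega)
          obtain ⟨f1, f2⟩ := hi (i+1) (by omega) hle
          have hC : ∀ B : Finset A, (∀ a ∈ B, a ∈ J) → satC I m (i+1) (sqcap P B) := by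
            intro B hB r hr
            simp only [sqcap, properPart, Finset.mem_filter] at hr
            obtain ⟨⟨hr, _⟩, rfl⟩ := hr
            by_cases hb : ∀ b ∈ r.bodyN, b ∉ M
            · rcases hJ r hr hb with ⟨a, ha, haJ⟩ | ⟨a, ha, haJ⟩
              · exact Or.inl ⟨a, ha, ih1 a haJ⟩
              · exact absurd (hB a ha) haJ
            · push Not at hb
              obtain ⟨b, hb, hbM⟩ := hb
              exact Or.inr ⟨b, hb, hbM.2⟩
          refine ⟨fun a ha => (f1 a (hJM ha).1 ?_).2 ⟨ih1 a ha, hC {a} ?_⟩,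
            f2.2 ⟨ih2, hC ∅ ?_⟩⟩
          · rintro rfl
            exact hmJ ha
          · simpa using ha
          · simp
      exact ht (key _ le_rfl).2
end
end

section
/- For every program P: if P is dual-normal then the translated program P_trans is normal, and if P is normal then P_trans is dual-normal. -/
open Classical

noncomputable section

variable {A : Type*} [DecidableEq A]

/- Atoms of the translated program: `Sum.inl a` is the original atom `a`,
`Sum.inr (Sum.inl x)` is the fresh atom `x̄`, and `Sum.inr (Sum.inr (y?, x))` is the fresh
atom `y_x` (with `y? = some y`) resp. `t_x` (with `y? = none`). -/
abbrev TA (A : Type*) := A ⊕ (A ⊕ (Option A × A))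

/-- The original atom `a`. -/
def orig (a : A) : TA A := Sum.inl a

/-- The fresh atom `x̄`. -/
def bar (x : A) : TA A := Sum.inr (Sum.inl x)

/-- The fresh atom `y_x` (`sub (some y) x`) resp. `t_x` (`sub none x`). -/
def sub (y : Option A) (x : A) : TA A := Sum.inr (Sum.inr (y, x))

/-- The program `P_x = { B⁺(r)_x ← H(r)_x, not B⁻(r) : r ∈ (P_r)[t] }`:
heads and positive bodies of the rules of `(P_r)[t]` are swapped and their atoms renamed
with subscript `x`; negative bodies keep the original atoms. -/
def Px (P : Program A) (x : A) : Program (TA A) :=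
  (properPart P).image (fun r =>
    ⟨if r.bodyP = ∅ then {sub none x} else r.bodyP.image (fun y => sub (some y) x),
     r.head.image (fun y => sub (some y) x),
     r.bodyN.image orig⟩)

/-- `P_xor = { {x} ← ∅, not {x̄} ; {x̄} ← ∅, not {x} : x ∈ at(P) }`. -/
def Pxor (P : Program A) : Program (TA A) :=
  (atoms P).image (fun x => ⟨{orig x}, ∅, {bar x}⟩) ∪
  (atoms P).image (fun x => ⟨{bar x}, ∅, {orig x}⟩)

/-- `P_aux = { {x_x} ← ∅, not {x̄} : x ∈ at(P) } ∪ { {y_x} ← ∅, not {x̄, y} : x, y ∈ at(P) }`. -/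
def Paux (P : Program A) : Program (TA A) :=
  (atoms P).image (fun x => ⟨{sub (some x) x}, ∅, {bar x}⟩) ∪
  ((atoms P) ×ˢ (atoms P)).image (fun p => ⟨{sub (some p.2) p.1}, ∅, {bar p.1, orig p.2}⟩)

/-- `P_diag = P_xor ∪ P_aux ∪ ⋃_{x ∈ at(P)} P_x`. -/
def Pdiag (P : Program A) : Program (TA A) :=
  Pxor P ∪ Paux P ∪ (atoms P).biUnion (fun x => Px P x)

/-- `P_mod = { ∅ ← B⁺(r), not (H(r) ∪ B⁻(r)) : r ∈ P }`. -/
def Pmod (P : Program A) : Program (TA A) :=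
  P.image (fun r => ⟨∅, r.bodyP.image orig, (r.head ∪ r.bodyN).image orig⟩)

/-- `P_true = { ∅ ← {x}, not {t_x} : x ∈ at(P) }`. -/
def Ptrue (P : Program A) : Program (TA A) :=
  (atoms P).image (fun x => ⟨∅, {orig x}, {sub none x}⟩)

/-- The translated program `P_trans = P_diag ∪ P_mod ∪ P_true`. -/
def Ptrans (P : Program A) : Program (TA A) := Pdiag P ∪ Pmod P ∪ Ptrue P

/-- The program `P_x^M ∪ {{x_x} ← ∅} ∪ {{y_x} ← ∅ : y ∈ at(P) \ M}`, where the reduct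
of `P_x` is taken relative to `M` (whose atoms are original atoms). -/
def PxM (P : Program A) (M : Set A) (x : A) : Program (TA A) :=
  reduct (Px P x) (orig '' M) ∪ {⟨{sub (some x) x}, ∅, ∅⟩} ∪
    ((atoms P).filter (fun y => y ∉ M)).image (fun y => ⟨{sub (some y) x}, ∅, ∅⟩)

/-- If `P` is dual-normal then `P_trans` is normal, and if `P` is normal
then `P_trans` is dual-normal. -/
theorem Ptrans_swaps_normal_dualNormal (P : Program A) :
    (dualNormal P → normal (Ptrans P)) ∧ (normal P → dualNormal (Ptrans P)) := by
  have hx : ∀ r ∈ Ptrans P,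
      (r.head.card ≤ 1 ∧ r.bodyP = ∅) ∨ r.head = ∅ ∨
      ∃ x, ∃ q ∈ P, q.head ≠ ∅ ∧
        r.head = (if q.bodyP = ∅ then {sub none x} else q.bodyP.image (fun y => sub (some y) x)) ∧
        r.bodyP = q.head.image (fun y => sub (some y) x) := by
    intro r hr
    simp only [Ptrans, Pdiag, Pxor, Paux, Px, Pmod, Ptrue, properPart, Finset.mem_union,
      Finset.mem_image, Finset.mem_biUnion, Finset.mem_filter] at hr
    rcases hr with ((((⟨x, _, rfl⟩ | ⟨x, _, rfl⟩) | (⟨x, _, rfl⟩ | ⟨x, _, rfl⟩)) |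
      ⟨x, _, q, ⟨hq, hne⟩, rfl⟩) | ⟨x, _, rfl⟩) | ⟨x, _, rfl⟩
    · left; simp
    · left; simp
    · left; simp
    · left; simp
    · right; right; exact ⟨x, q, hq, hne, rfl, rfl⟩
    · right; left; rfl
    · right; left; rfl
  constructor
  · intro h r hr
    rcases hx r hr with h1 | h1 | ⟨x, q, hq, hne, h1, h2⟩
    · exact h1.1
    · simp [h1]
    · rw [h1]
      split_ifs
      · simp
      · exact Finset.card_image_le.trans ((h q hq).resolve_left hne)
  · intro h r hr
    rcases hx r hr with h1 | h1 | ⟨x, q, hq, hne, h1, h2⟩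
    · right; simp [h1.2]
    · left; exact h1
    · right
      rw [h2]
      exact Finset.card_image_le.trans (h q hq)
end
end

section
/- For every program P: if P is head-cycle free then the translated program P_trans is body-cycle free, and if P is body-cycle free then P_trans is head-cycle free. -/
open Classical

noncomputable section

variable {A : Type*} [DecidableEq A]

/-- Edge of the positive dependency digraph: from `x` to `y` when some rule has `x` in the
head and `y` in the positive body. -/
def depEdge (P : Program B) (x y : B) : Prop := ∃ r ∈ P, x ∈ r.head ∧ y ∈ r.bodyP

/-- Two atoms lie on a common directed cycle of the positive dependency digraph. -/
def sameCycle (P : Program B) (x y : B) : Prop :=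
  Relation.ReflTransGen (depEdge P) x y ∧ Relation.ReflTransGen (depEdge P) y x

/-- Head-cycle free: no directed cycle contains two distinct atoms occurring together in
the head of a single rule. -/
def HCF (P : Program B) : Prop :=
  ∀ r ∈ P, ∀ x ∈ r.head, ∀ y ∈ r.head, x ≠ y → ¬ sameCycle P x y

/-- Body-cycle free: no directed cycle contains two distinct atoms occurring together in
the positive body of a single rule. -/
def BCF (P : Program B) : Prop :=
  ∀ r ∈ P, ∀ x ∈ r.bodyP, ∀ y ∈ r.bodyP, x ≠ y → ¬ sameCycle P x y


/-- Edges of the dependency digraph of the translated program. -/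
theorem depEdge_Ptrans {P : Program A} {a b : TA A} (h : depEdge (Ptrans P) a b) :
    ∃ (u : Option A) (x w : A), a = sub u x ∧ b = sub (some w) x ∧
      ∀ z, u = some z → depEdge P w z := by
  obtain ⟨r, hr, ha, hb⟩ := h
  simp only [Ptrans, Pdiag, Pxor, Paux, Pmod, Ptrue, Px, Finset.mem_union, Finset.mem_image,
    Finset.mem_biUnion] at hr
  rcases hr with ((((⟨x, _, rfl⟩ | ⟨x, _, rfl⟩) | (⟨x, _, rfl⟩ | ⟨x, _, rfl⟩)) |
    ⟨x, _, r, hr, rfl⟩) | ⟨x, _, rfl⟩) | ⟨x, _, rfl⟩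
  · simp at hb
  · simp at hb
  · simp at hb
  · simp at hb
  · simp only [Finset.mem_image] at hb
    obtain ⟨w, hw, rfl⟩ := hb
    have hrP : r ∈ P := (Finset.mem_filter.1 hr).1
    dsimp only at ha
    split_ifs at ha with h0
    · rw [Finset.mem_singleton] at ha
      exact ⟨none, x, w, ha, rfl, by simp⟩
    · obtain ⟨z, hz, rfl⟩ := Finset.mem_image.1 ha
      refine ⟨some z, x, w, rfl, rfl, ?_⟩
      intro z' hz'
      cases hz'
      exact ⟨r, hrP, hw, hz⟩
  · simp at ha
  · simp at ha

theorem path_sub {P : Program A} {z x : A} {b : TA A}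
    (h : Relation.ReflTransGen (depEdge (Ptrans P)) (sub (some z) x) b) :
    ∃ w, b = sub (some w) x ∧ Relation.ReflTransGen (depEdge P) w z := by
  induction h with
  | refl => exact ⟨z, rfl, .refl⟩
  | tail _ he ih =>
    obtain ⟨w, rfl, hw⟩ := ih
    obtain ⟨u, x', w', h1, h2, h3⟩ := depEdge_Ptrans he
    simp only [sub, Sum.inr.injEq, Prod.mk.injEq] at h1
    obtain ⟨rfl, rfl⟩ := h1
    exact ⟨w', h2, .head (h3 _ rfl) hw⟩

theorem sameCycle_sub {P : Program A} {z y x : A}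
    (h : sameCycle (Ptrans P) (sub (some z) x) (sub (some y) x)) : sameCycle P z y := by
  obtain ⟨h1, h2⟩ := h
  obtain ⟨w, e1, h1⟩ := path_sub h1
  obtain ⟨w', e2, h2⟩ := path_sub h2
  simp only [sub, Sum.inr.injEq, Prod.mk.injEq, Option.some.injEq, and_true] at e1 e2
  subst e1 e2
  exact ⟨h2, h1⟩

theorem path_orig {P : Program A} {z : A} {b : TA A}
    (h : Relation.ReflTransGen (depEdge (Ptrans P)) (orig z) b) : b = orig z := by
  rcases Relation.ReflTransGen.cases_head h with h | ⟨c, hc, _⟩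
  · exact h.symm
  · obtain ⟨u, x, w, h1, _⟩ := depEdge_Ptrans hc
    simp [orig, sub] at h1

/-- If `P` is head-cycle free then `P_trans` is body-cycle free, and if
`P` is body-cycle free then `P_trans` is head-cycle free. -/
theorem Ptrans_swaps_HCF_BCF (P : Program A) :
    (HCF P → BCF (Ptrans P)) ∧ (BCF P → HCF (Ptrans P)) := by
  constructor
  · intro H r hr a ha b hb hab hc
    simp only [Ptrans, Pdiag, Pxor, Paux, Pmod, Ptrue, Px, Finset.mem_union, Finset.mem_image,
      Finset.mem_biUnion] at hr
    rcases hr with ((((⟨x, _, rfl⟩ | ⟨x, _, rfl⟩) | (⟨x, _, rfl⟩ | ⟨x, _, rfl⟩)) |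
      ⟨x, _, r, hr, rfl⟩) | ⟨r, _, rfl⟩) | ⟨x, _, rfl⟩
    · simp at hb
    · simp at hb
    · simp at hb
    · simp at hb
    · obtain ⟨y, hy, rfl⟩ := Finset.mem_image.1 ha
      obtain ⟨z, hz, rfl⟩ := Finset.mem_image.1 hb
      exact H r (Finset.mem_filter.1 hr).1 y hy z hz (fun e => hab (by rw [e])) (sameCycle_sub hc)
    · obtain ⟨y, hy, rfl⟩ := Finset.mem_image.1 ha
      exact hab (path_orig hc.1).symm
    · exact hab ((Finset.mem_singleton.1 ha).trans (Finset.mem_singleton.1 hb).symm)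
  · intro H r hr a ha b hb hab hc
    simp only [Ptrans, Pdiag, Pxor, Paux, Pmod, Ptrue, Px, Finset.mem_union, Finset.mem_image,
      Finset.mem_biUnion] at hr
    rcases hr with ((((⟨x, _, rfl⟩ | ⟨x, _, rfl⟩) | (⟨x, _, rfl⟩ | ⟨x, _, rfl⟩)) |
      ⟨x, _, r, hr, rfl⟩) | ⟨r, _, rfl⟩) | ⟨x, _, rfl⟩
    · exact hab ((Finset.mem_singleton.1 ha).trans (Finset.mem_singleton.1 hb).symm)
    · exact hab ((Finset.mem_singleton.1 ha).trans (Finset.mem_singleton.1 hb).symm)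
    · exact hab ((Finset.mem_singleton.1 ha).trans (Finset.mem_singleton.1 hb).symm)
    · exact hab ((Finset.mem_singleton.1 ha).trans (Finset.mem_singleton.1 hb).symm)
    · dsimp only at ha hb
      split_ifs at ha hb with h0
      · exact hab ((Finset.mem_singleton.1 ha).trans (Finset.mem_singleton.1 hb).symm)
      · obtain ⟨y, hy, rfl⟩ := Finset.mem_image.1 ha
        obtain ⟨z, hz, rfl⟩ := Finset.mem_image.1 hb
        exact H r (Finset.mem_filter.1 hr).1 y hy z hz (fun e => hab (by rw [e]))
          (sameCycle_sub hc)
    · simp at ha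
    · simp at ha
end
end

section
/- If a UE-complete set S of SE-interpretations is splittable, then S is closed under here-union. -/
open Classical

noncomputable section

variable {A : Type*} [DecidableEq A]

/-- `(X, Y)` is an SE-model of `P` iff `Y ⊨ P` and `X ⊨ P^Y`
(SE-interpretations additionally require `X ⊆ Y`). -/
def isSEModel (P : Program A) (X Y : Set A) : Prop :=
  isModel Y P ∧ isModel X (reduct P Y)

/-- The set of all SE-models of `P` (as SE-interpretations, i.e. with `X ⊆ Y`). -/
def SEset (P : Program A) : Set (Set A × Set A) :=
  {p | p.1 ⊆ p.2 ∧ isSEModel P p.1 p.2}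

/-- `(X, Y)` is a UE-model of `P`: an SE-model such that every SE-model `(X', Y)` with
`X ⊊ X'` satisfies `X' = Y`. -/
def isUEModel (P : Program A) (X Y : Set A) : Prop :=
  isSEModel P X Y ∧ ∀ X' : Set A, X' ⊆ Y → isSEModel P X' Y → X ⊂ X' → X' = Y

/-- The set of all UE-models of `P` (as SE-interpretations, i.e. with `X ⊆ Y`). -/
def UEset (P : Program A) : Set (Set A × Set A) :=
  {p | p.1 ⊆ p.2 ∧ isUEModel P p.1 p.2}

/-- A set of SE-interpretations is complete. -/
def completeSE {B : Type*} (S : Set (Set B × Set B)) : Prop :=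
  (∀ X Y : Set B, (X, Y) ∈ S → (Y, Y) ∈ S) ∧
  (∀ X Y Z : Set B, (X, Y) ∈ S → (Z, Z) ∈ S → Y ⊆ Z → (X, Z) ∈ S)

/-- A set of SE-interpretations is closed under here-union. -/
def closedHereUnion {B : Type*} (S : Set (Set B × Set B)) : Prop :=
  ∀ X X' Y : Set B, (X, Y) ∈ S → (X', Y) ∈ S → (X ∪ X', Y) ∈ S

/-- A set of SE-interpretations is UE-complete. -/
def UEComplete {B : Type*} (S : Set (Set B × Set B)) : Prop :=
  (∀ X Y : Set B, (X, Y) ∈ S → (Y, Y) ∈ S) ∧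
  (∀ X Y Z : Set B, (X, Y) ∈ S → (Z, Z) ∈ S → Y ⊂ Z →
    ∃ Y' : Set B, Y ⊆ Y' ∧ Y' ⊂ Z ∧ (Y', Z) ∈ S) ∧
  (∀ X X' Y : Set B, (X, Y) ∈ S → (X', Y) ∈ S → X ⊂ X' → X' = Y)

/-- A set of SE-interpretations is splittable: for every `(Z,Z) ∈ S` and every finite
nonempty family `(X₁,Y₁), …, (X_k,Y_k) ∈ S` with all `Yᵢ ⊆ Z`, either
`(X₁ ∪ ⋯ ∪ X_k, Z) ∈ S` or `(Z', Z) ∈ S` for some `Z'` with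
`X₁ ∪ ⋯ ∪ X_k ⊆ Z' ⊊ Z`. -/
def splittable {B : Type*} (S : Set (Set B × Set B)) : Prop :=
  ∀ Z : Set B, (Z, Z) ∈ S →
    ∀ (n : ℕ) (p : Fin (n + 1) → Set B × Set B),
      (∀ i, p i ∈ S) → (∀ i, (p i).2 ⊆ Z) →
      ((⋃ i, (p i).1), Z) ∈ S ∨
        ∃ Z' : Set B, (⋃ i, (p i).1) ⊆ Z' ∧ Z' ⊂ Z ∧ (Z', Z) ∈ S

/-- A UE-complete, splittable set of SE-interpretations is closed under
here-union. -/
theorem splittable_UEComplete_closedHereUnion {B : Type*} (S : Set (Set B × Set B))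
    (hSE : ∀ p ∈ S, p.1 ⊆ p.2) (hUE : UEComplete S) (hsp : splittable S) :
    closedHereUnion S := by
  intro X X' Y h h'
  have hY := hUE.1 X Y h
  have hU : (⋃ i, ((![(X, Y), (X', Y)] : Fin 2 → Set B × Set B) i).1) = X ∪ X' := by
    ext x
    simp [Fin.exists_fin_two]
  have key := hsp Y hY 1 ![(X, Y), (X', Y)]
    (by intro i; fin_cases i <;> simpa) (by intro i; fin_cases i <;> simp)
  rw [hU] at key
  rcases key with hk | ⟨Z', hsub, hss, hZ⟩
  · exact hk
  · have hX : X = Z' := by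
      by_contra hne
      have hlt : X ⊂ Z' :=
        (Set.subset_union_left.trans hsub).ssubset_of_ne hne
      exact hss.ne (hUE.2.2 X Z' Y h hZ hlt)
    have hE : X ∪ X' = Z' :=
      Set.Subset.antisymm hsub (hX ▸ Set.subset_union_left)
    rw [hE]
    exact hZ
end
end

section
/- For every dual-normal program P, the set SE(P) of all SE-models of P is complete and closed under here-union. -/
open Classical

noncomputable section

variable {A : Type*} [DecidableEq A]

theorem isModel_reduct_iff_aux (P : Program A) (X Y : Set A) :
    isModel X (reduct P Y) ↔ ∀ r ∈ P, (∀ a ∈ r.bodyN, a ∉ Y) →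
      (∃ a ∈ r.head, a ∈ X) ∨ (∃ a ∈ r.bodyP, a ∉ X) := by
  unfold isModel reduct satR
  constructor
  · intro h r hr hn
    have := h ⟨r.head, r.bodyP, ∅⟩
      (Finset.mem_image.2 ⟨r, Finset.mem_filter.2 ⟨hr, hn⟩, rfl⟩)
    simpa using this
  · intro h r' hr'
    obtain ⟨r, hr, rfl⟩ := Finset.mem_image.1 hr'
    obtain ⟨hr, hn⟩ := Finset.mem_filter.1 hr
    simpa using h r hr hn

theorem mem_SEset_iff_aux (P : Program A) (X Y : Set A) :
    (X, Y) ∈ SEset P ↔ X ⊆ Y ∧ isModel Y P ∧ ∀ r ∈ P, (∀ a ∈ r.bodyN, a ∉ Y) →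
      (∃ a ∈ r.head, a ∈ X) ∨ (∃ a ∈ r.bodyP, a ∉ X) := by
  rw [← isModel_reduct_iff_aux]
  rfl

/-- For every dual-normal program `P`, the set of SE-models of `P` is
complete and closed under here-union. -/
theorem dualNormal_SEset_complete_closedHereUnion (P : Program A) (hP : dualNormal P) :
    completeSE (SEset P) ∧ closedHereUnion (SEset P) := by
  have key : ∀ Y : Set A, isModel Y P → ∀ r ∈ P, (∀ a ∈ r.bodyN, a ∉ Y) →
      (∃ a ∈ r.head, a ∈ Y) ∨ (∃ a ∈ r.bodyP, a ∉ Y) := by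
    intro Y hY r hr hn
    rcases hY r hr with ⟨a, ha, haY⟩ | h
    · rcases Finset.mem_union.1 ha with h | h
      · exact Or.inl ⟨a, h, haY⟩
      · exact absurd haY (hn a h)
    · exact Or.inr h
  refine ⟨⟨?_, ?_⟩, ?_⟩
  · intro X Y h
    rw [mem_SEset_iff_aux] at h ⊢
    exact ⟨subset_rfl, h.2.1, key Y h.2.1⟩
  · intro X Y Z h hZ hYZ
    rw [mem_SEset_iff_aux] at h hZ ⊢
    exact ⟨h.1.trans hYZ, hZ.2.1, fun r hr hn =>
      h.2.2 r hr (fun a ha haY => hn a ha (hYZ haY))⟩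
  · intro X X' Y h h'
    rw [mem_SEset_iff_aux] at h h' ⊢
    refine ⟨Set.union_subset h.1 h'.1, h.2.1, fun r hr hn => ?_⟩
    rcases h.2.2 r hr hn with ⟨a, ha, haX⟩ | ⟨b, hb, hbX⟩
    · exact Or.inl ⟨a, ha, Or.inl haX⟩
    rcases h'.2.2 r hr hn with ⟨a, ha, haX⟩ | ⟨c, hc, hcX⟩
    · exact Or.inl ⟨a, ha, Or.inr haX⟩
    rcases hP r hr with he | hcard
    · rcases key Y h.2.1 r hr hn with ⟨a, ha, _⟩ | ⟨a, ha, haY⟩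
      · simp [he] at ha
      · exact Or.inr ⟨a, ha, fun hu => haY (Set.union_subset h.1 h'.1 hu)⟩
    · have hbc : b = c := Finset.card_le_one.1 hcard b hb c hc
      subst hbc
      exact Or.inr ⟨b, hb, fun hu => hu.elim hbX hcX⟩
end
end

section
/- Let A be a finite set of atoms and U ⊆ S_A a set of SE-interpretations over A that is UE-complete and splittable. Then there exists a dual-normal program P with at(P) ⊆ A such that {(X,Y) ∈ S_A : (X,Y) is a UE-model of P} = U. -/
open Classical

noncomputable section

variable {A : Type*} [DecidableEq A]

/-- The SE-satisfaction of a single rule. -/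
def seSat (X Y : Set A) (r : Rule A) : Prop :=
  satR Y r ∧ ((∀ a ∈ r.bodyN, a ∉ Y) → (∃ a ∈ r.head, a ∈ X) ∨ ∃ a ∈ r.bodyP, a ∉ X)

theorem isSEModel_iff_seSat (P : Program A) (X Y : Set A) :
    isSEModel P X Y ↔ ∀ r ∈ P, seSat X Y r := by
  unfold isSEModel isModel reduct seSat
  constructor
  · rintro ⟨h1, h2⟩ r hr
    refine ⟨h1 r hr, fun hn => ?_⟩
    have := h2 ⟨r.head, r.bodyP, ∅⟩
      (Finset.mem_image.2 ⟨r, Finset.mem_filter.2 ⟨hr, hn⟩, rfl⟩)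
    simpa [satR] using this
  · intro h
    refine ⟨fun r hr => (h r hr).1, ?_⟩
    intro r' hr'
    obtain ⟨r, hr, rfl⟩ := Finset.mem_image.1 hr'
    obtain ⟨hr, hn⟩ := Finset.mem_filter.1 hr
    simpa [satR] using (h r hr).2 hn

/-- The intended set of SE-models: unions of here-parts. -/
def TT (U : Set (Set A × Set A)) (V Z : Set A) : Prop :=
  V ⊆ Z ∧ (Z, Z) ∈ U ∧ (∃ p ∈ U, p.2 ⊆ Z ∧ p.1 ⊆ V) ∧
    ∀ a ∈ V, ∃ p ∈ U, p.2 ⊆ Z ∧ p.1 ⊆ V ∧ a ∈ p.1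

/-- All rules over `Afin`. -/
def allRules (Afin : Finset A) : Program A :=
  (Afin.powerset ×ˢ Afin.powerset ×ˢ Afin.powerset).image (fun t => ⟨t.1, t.2.1, t.2.2⟩)

theorem mem_allRules (Afin : Finset A) (r : Rule A) :
    r ∈ allRules Afin ↔ r.head ⊆ Afin ∧ r.bodyP ⊆ Afin ∧ r.bodyN ⊆ Afin := by
  unfold allRules
  rw [Finset.mem_image]
  constructor
  · rintro ⟨t, ht, rfl⟩
    simpa using ht
  · intro h
    exact ⟨(r.head, r.bodyP, r.bodyN), by simpa using h, rfl⟩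

/-- The canonical program. -/
def canonP (Afin : Finset A) (U : Set (Set A × Set A)) : Program A :=
  (allRules Afin).filter (fun r => (r.head = ∅ ∨ r.bodyP.card ≤ 1) ∧
    ∀ X Y, TT U X Y → seSat X Y r)

theorem TT_mono {U : Set (Set A × Set A)} {V Y Z : Set A} (h : TT U V Y) (hZ : (Z, Z) ∈ U)
    (hYZ : Y ⊆ Z) : TT U V Z := by
  obtain ⟨h1, -, ⟨p, hp, hp2, hp1⟩, h4⟩ := h
  refine ⟨h1.trans hYZ, hZ, ⟨p, hp, hp2.trans hYZ, hp1⟩, fun a ha => ?_⟩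
  obtain ⟨p, hp, hp2, hp1⟩ := h4 a ha
  exact ⟨p, hp, hp2.trans hYZ, hp1⟩

theorem TT_of_mem {U : Set (Set A × Set A)} {X Y : Set A} (hXY : X ⊆ Y) (h : (X, Y) ∈ U)
    (hY : (Y, Y) ∈ U) : TT U X Y :=
  ⟨hXY, hY, ⟨_, h, subset_rfl, subset_rfl⟩, fun _ ha => ⟨_, h, subset_rfl, subset_rfl, ha⟩⟩

theorem isSEModel_canonP (Afin : Finset A) (U : Set (Set A × Set A))
    (hU : ∀ p ∈ U, p.1 ⊆ p.2 ∧ p.2 ⊆ ↑Afin) (X Y : Set A) (hXY : X ⊆ Y) (hY : Y ⊆ ↑Afin) :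
    isSEModel (canonP Afin U) X Y ↔ TT U X Y := by
  rw [isSEModel_iff_seSat]
  constructor
  · intro h
    have key : ∀ r : Rule A, r.head ⊆ Afin → r.bodyP ⊆ Afin → r.bodyN ⊆ Afin →
        (r.head = ∅ ∨ r.bodyP.card ≤ 1) → (∀ X Y, TT U X Y → seSat X Y r) → seSat X Y r :=
      fun r h1 h2 h3 h4 h5 => h r
        (Finset.mem_filter.2 ⟨(mem_allRules _ _).2 ⟨h1, h2, h3⟩, h4, h5⟩)
    have hYU : (Y, Y) ∈ U := by
      by_contra hYU
      have := key ⟨∅, Afin.filter (· ∈ Y), Afin.filter (· ∉ Y)⟩ (by simp)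
        (Finset.filter_subset _ _) (Finset.filter_subset _ _) (Or.inl rfl) ?_
      · have := this.1
        simp only [satR, Finset.empty_union, Finset.mem_filter] at this
        grind
      · intro X' Y' hT
        have hY'A := (hU _ hT.2.1).2
        have hne : ¬ (Y' ⊆ Y ∧ Y ⊆ Y') := fun hh =>
          hYU (by rw [← Set.Subset.antisymm hh.1 hh.2]; exact hT.2.1)
        have hX'Y' := hT.1
        simp only [seSat, satR, Finset.empty_union, Finset.mem_filter]
        simp only [Set.subset_def] at *
        constructor
        · by_contra hcon
          push Not at hcon
          apply hne
          constructor
          · intro a ha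
            by_contra hn
            exact hcon.1 a ⟨hY'A a ha, hn⟩ ha
          · intro a ha
            exact hcon.2 a ⟨hY a ha, ha⟩
        · intro hn
          right
          by_contra hcon
          push Not at hcon
          apply hne
          constructor
          · intro a ha
            by_contra hn'
            exact hn a ⟨hY'A a ha, hn'⟩ ha
          · intro a ha
            exact hX'Y' a (hcon a ⟨hY a ha, ha⟩)
    have gen : ∀ B : Finset A, (B : Set A) ⊆ X → B.card ≤ 1 →
        (∀ V, TT U V Y → V ⊆ X → ∃ a ∈ B, a ∉ V) → False := by
      intro B hB hB1 hV
      have := key ⟨Afin.filter (fun a => a ∈ Y ∧ a ∉ X), B, Afin.filter (· ∉ Y)⟩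
        (Finset.filter_subset _ _) (fun a ha => hY (hXY (hB ha)))
        (Finset.filter_subset _ _) (Or.inr hB1) ?_
      · have := this.2 (by simp)
        rcases this with ⟨a, ha, haX⟩ | ⟨a, ha, haX⟩
        · exact (Finset.mem_filter.1 ha).2.2 haX
        · exact haX (hB ha)
      · intro X' Y' hT
        have hY'A : Y' ⊆ ↑Afin := (hU _ hT.2.1).2
        have sat : Y' ⊆ Y → ∀ V, TT U V Y' →
            (∃ a ∈ Afin.filter (fun a => a ∈ Y ∧ a ∉ X), a ∈ V) ∨ ∃ a ∈ B, a ∉ V := by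
          intro hs V hVT
          by_cases hVX : V ⊆ X
          · exact Or.inr (hV V (TT_mono hVT hYU hs) hVX)
          · left
            obtain ⟨a, ha, haX⟩ := Set.not_subset.1 hVX
            have haY' := hVT.1 ha
            exact ⟨a, Finset.mem_filter.2 ⟨hY'A haY', hs haY', haX⟩, ha⟩
        have hsub : (∀ a ∈ Afin.filter (· ∉ Y), a ∉ Y') → Y' ⊆ Y := by
          intro hn a ha
          by_contra hn'
          exact hn a (Finset.mem_filter.2 ⟨hY'A ha, hn'⟩) ha
        refine ⟨?_, fun hn => sat (hsub hn) _ hT⟩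
        by_cases hn : ∀ a ∈ Afin.filter (· ∉ Y), a ∉ Y'
        · rcases sat (hsub hn) Y' (TT_of_mem subset_rfl hT.2.1 hT.2.1) with ⟨a, ha, h'⟩ | h'
          · exact Or.inl ⟨a, Finset.mem_union_left _ ha, h'⟩
          · exact Or.inr h'
        · push Not at hn
          obtain ⟨a, ha, h'⟩ := hn
          exact Or.inl ⟨a, Finset.mem_union_right _ ha, h'⟩
    refine ⟨hXY, hYU, ?_, ?_⟩
    · by_contra hno
      refine gen ∅ (by simp) (by simp) ?_
      intro V hV hVX
      obtain ⟨p, hp, hp2, hp1⟩ := hV.2.2.1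
      exact absurd ⟨p, hp, hp2, hp1.trans hVX⟩ hno
    · intro a ha
      by_contra hno
      refine gen {a} (by simpa using ha) (by simp) ?_
      intro V hV hVX
      refine ⟨a, by simp, fun haV => ?_⟩
      obtain ⟨p, hp, hp2, hp1, hpa⟩ := hV.2.2.2 a haV
      exact hno ⟨p, hp, hp2, hp1.trans hVX, hpa⟩
  · intro h r hr
    exact (Finset.mem_filter.1 hr).2.2 X Y h

theorem TT_split (Afin : Finset A) (U : Set (Set A × Set A))
    (hU : ∀ p ∈ U, p.1 ⊆ p.2 ∧ p.2 ⊆ ↑Afin) (hsp : splittable U) {X Z : Set A}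
    (h : TT U X Z) (hne : X ≠ Z) : ∃ Z', X ⊆ Z' ∧ Z' ⊂ Z ∧ (Z', Z) ∈ U := by
  obtain ⟨hXZ, hZ, ⟨p0, hp0, hp02, hp01⟩, hcov⟩ := h
  have hfin : {p : Set A × Set A | p ∈ U ∧ p.2 ⊆ Z ∧ p.1 ⊆ X}.Finite := by
    have hF : {s : Set A | s ⊆ ↑Afin}.Finite := Afin.finite_toSet.finite_subsets
    refine (hF.prod hF).subset ?_
    rintro p ⟨hp, -⟩
    exact ⟨(hU p hp).1.trans (hU p hp).2, (hU p hp).2⟩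
  obtain ⟨n, f, hf⟩ := hfin.fin_param
  have hn : n ≠ 0 := by
    rintro rfl
    have : p0 ∈ Set.range f := by rw [hf.2]; exact ⟨hp0, hp02, hp01⟩
    obtain ⟨i, -⟩ := this
    exact i.elim0
  obtain ⟨n, rfl⟩ := Nat.exists_eq_succ_of_ne_zero hn
  have hmem : ∀ i, f i ∈ U ∧ (f i).2 ⊆ Z ∧ (f i).1 ⊆ X := fun i => by
    have : f i ∈ Set.range f := ⟨i, rfl⟩
    rw [hf.2] at this
    exact this
  have hun : (⋃ i, (f i).1) = X := by
    apply Set.Subset.antisymm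
    · exact Set.iUnion_subset fun i => (hmem i).2.2
    · intro a ha
      obtain ⟨p, hp, hp2, hp1, hpa⟩ := hcov a ha
      have : p ∈ Set.range f := by rw [hf.2]; exact ⟨hp, hp2, hp1⟩
      obtain ⟨i, rfl⟩ := this
      exact Set.mem_iUnion.2 ⟨i, hpa⟩
  have := hsp Z hZ n f (fun i => (hmem i).1) (fun i => (hmem i).2.1)
  rw [hun] at this
  rcases this with h | h
  · exact ⟨X, subset_rfl, hXZ.ssubset_of_ne hne, h⟩
  · exact h

/-- For every finite set `A` of atoms and every set `U ⊆ S_A` of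
SE-interpretations over `A` that is UE-complete and splittable, there is a dual-normal
program `P` with `at(P) ⊆ A` whose UE-models over `S_A` are exactly `U`. -/
theorem UEComplete_splittable_realized_by_dualNormal
    (Afin : Finset A) (U : Set (Set A × Set A))
    (hU : ∀ p ∈ U, p.1 ⊆ p.2 ∧ p.2 ⊆ ↑Afin)
    (hc : UEComplete U) (hsp : splittable U) :
    ∃ P : Program A, ↑(atoms P) ⊆ (↑Afin : Set A) ∧ dualNormal P ∧
      {p : Set A × Set A | p.1 ⊆ p.2 ∧ p.2 ⊆ ↑Afin ∧ isUEModel P p.1 p.2} = U := by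
  refine ⟨canonP Afin U, ?_, ?_, ?_⟩
  · rw [Finset.coe_subset]
    refine Finset.sup_le fun r hr => ?_
    obtain ⟨h1, h2, h3⟩ := (mem_allRules _ _).1 (Finset.mem_filter.1 hr).1
    exact Finset.union_subset (Finset.union_subset h1 h2) h3
  · intro r hr
    exact (Finset.mem_filter.1 hr).2.1
  · ext ⟨X, Y⟩
    simp only [Set.mem_setOf_eq]
    constructor
    · rintro ⟨hXY, hY, hse, hmax⟩
      have hT := (isSEModel_canonP Afin U hU X Y hXY hY).1 hse
      by_cases hne : X = Y
      · subst hne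
        exact hT.2.1
      · obtain ⟨Z', h1, h2, h3⟩ := TT_split Afin U hU hsp hT hne
        by_cases hXZ : X = Z'
        · subst hXZ
          exact h3
        · have := hmax Z' h2.subset ((isSEModel_canonP Afin U hU Z' Y h2.subset hY).2
            (TT_of_mem h2.subset h3 hT.2.1)) (h1.ssubset_of_ne hXZ)
          exact absurd this h2.ne
    · intro h
      obtain ⟨hXY, hY⟩ := hU _ h
      have hYU := hc.1 _ _ h
      refine ⟨hXY, hY, (isSEModel_canonP Afin U hU X Y hXY hY).2 (TT_of_mem hXY h hYU), ?_⟩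
      intro X' hX'Y hse hXX'
      have hT := (isSEModel_canonP Afin U hU X' Y hX'Y hY).1 hse
      by_contra hne
      obtain ⟨Z', h1, h2, h3⟩ := TT_split Afin U hU hsp hT hne
      exact h2.ne (hc.2.2 X Z' Y h h3 (hXX'.trans_subset h1))
end
end

section
/- Over the four distinct atoms a, b, c, d, the set S = {({b},{b}), ({c},{c}), ({a,b},{a,b,c,d}), ({c,d},{a,b,c,d}), ({a,b,c,d},{a,b,c,d})} of SE-interpretations is UE-complete and closed under here-union, but S is not splittable. -/
open Classical

noncomputable section

variable {A : Type*} [DecidableEq A]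

/-- Over four distinct atoms `a, b, c, d`, the set
`S = {({b},{b}), ({c},{c}), ({a,b},{a,b,c,d}), ({c,d},{a,b,c,d}), ({a,b,c,d},{a,b,c,d})}`
is UE-complete and closed under here-union, but not splittable. -/
theorem UEComplete_closedHereUnion_not_splittable_example
    (a b c d : A) (hab : a ≠ b) (hac : a ≠ c) (had : a ≠ d)
    (hbc : b ≠ c) (hbd : b ≠ d) (hcd : c ≠ d) :
    UEComplete ({(({b} : Set A), ({b} : Set A)),
                 (({c} : Set A), ({c} : Set A)),
                 (({a, b} : Set A), ({a, b, c, d} : Set A)),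
                 (({c, d} : Set A), ({a, b, c, d} : Set A)),
                 (({a, b, c, d} : Set A), ({a, b, c, d} : Set A))} :
       Set (Set A × Set A)) ∧
    closedHereUnion ({(({b} : Set A), ({b} : Set A)),
                 (({c} : Set A), ({c} : Set A)),
                 (({a, b} : Set A), ({a, b, c, d} : Set A)),
                 (({c, d} : Set A), ({a, b, c, d} : Set A)),
                 (({a, b, c, d} : Set A), ({a, b, c, d} : Set A))} :
       Set (Set A × Set A)) ∧
    ¬ splittable ({(({b} : Set A), ({b} : Set A)),
                 (({c} : Set A), ({c} : Set A)),
                 (({a, b} : Set A), ({a, b, c, d} : Set A)),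
                 (({c, d} : Set A), ({a, b, c, d} : Set A)),
                 (({a, b, c, d} : Set A), ({a, b, c, d} : Set A))} :
       Set (Set A × Set A)) := by
  have hBC : ¬ ({b} : Set A) ⊆ {c} := by simp [hbc]
  have hCB : ¬ ({c} : Set A) ⊆ {b} := by simp [hbc.symm]
  have hUB : ¬ ({a, b, c, d} : Set A) ⊆ {b} := fun h => hab (h (by simp))
  have hUC : ¬ ({a, b, c, d} : Set A) ⊆ {c} := fun h => hac (h (by simp))
  have hcP : c ∉ ({a, b} : Set A) := by simp [hac.symm, hbc.symm]
  have hbQ : b ∉ ({c, d} : Set A) := by simp [hbc, hbd]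
  have hPQ : ¬ ({a, b} : Set A) ⊆ {c, d} := fun h => hbQ (h (by simp))
  have hQP : ¬ ({c, d} : Set A) ⊆ {a, b} := fun h => hcP (h (by simp))
  have hBP : ({b} : Set A) ⊆ {a, b} := by simp
  have hCQ : ({c} : Set A) ⊆ {c, d} := by simp
  have hU : ({a, b} : Set A) ∪ {c, d} = {a, b, c, d} := by ext x; simp; tauto
  have hPU : ({a, b} : Set A) ⊆ {a, b, c, d} := hU ▸ Set.subset_union_left
  have hQU : ({c, d} : Set A) ⊆ {a, b, c, d} := hU ▸ Set.subset_union_right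
  have hbcP : ¬ ({b} ∪ {c} : Set A) ⊆ {a, b} := fun h => hcP (h (by simp))
  have hbcQ : ¬ ({b} ∪ {c} : Set A) ⊆ {c, d} := fun h => hbQ (h (by simp))
  have haBC : ¬ ({a, b, c, d} : Set A) ⊆ {b} ∪ {c} := by
    intro h
    have : a ∈ ({b} ∪ {c} : Set A) := h (by simp)
    simp [hab, hac] at this
  generalize ({a, b, c, d} : Set A) = U at *
  generalize ({a, b} : Set A) = P at *
  generalize ({c, d} : Set A) = Q at *
  generalize ({b} : Set A) = B at *
  generalize ({c} : Set A) = C at *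
  have hUP : ¬ U ⊆ P := fun h => hQP (hQU.trans h)
  have hUQ : ¬ U ⊆ Q := fun h => hPQ (hPU.trans h)
  refine ⟨⟨?_, ?_, ?_⟩, ?_, ?_⟩
  · intro X Y h
    simp only [Set.mem_insert_iff, Set.mem_singleton_iff, Prod.mk.injEq] at h ⊢
    tauto
  · intro X Y Z h h' hYZ
    simp only [Set.mem_insert_iff, Set.mem_singleton_iff, Prod.mk.injEq] at h h' ⊢
    have hZ : Z = B ∨ Z = C ∨ Z = U := by grind
    have hY : Y = B ∨ Y = C ∨ Y = U := by grind
    rcases hZ with rfl | rfl | rfl <;> rcases hY with rfl | rfl | rfl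
    · exact absurd hYZ (ssubset_irrefl _)
    · exact absurd hYZ.1 hCB
    · exact absurd hYZ.1 hUB
    · exact absurd hYZ.1 hBC
    · exact absurd hYZ (ssubset_irrefl _)
    · exact absurd hYZ.1 hUC
    · exact ⟨P, hBP, ⟨hPU, hUP⟩, by simp⟩
    · exact ⟨Q, hCQ, ⟨hQU, hUQ⟩, by simp⟩
    · exact absurd hYZ (ssubset_irrefl _)
  · intro X X' Y h h' hX
    have h1 := hX.1
    have h2 := hX.2
    simp only [Set.mem_insert_iff, Set.mem_singleton_iff, Prod.mk.injEq] at h h'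
    grind
  · intro X X' Y h h'
    have e1 : P ∪ U = U := Set.union_eq_self_of_subset_left hPU
    have e2 : Q ∪ U = U := Set.union_eq_self_of_subset_left hQU
    simp only [Set.mem_insert_iff, Set.mem_singleton_iff, Prod.mk.injEq] at h h' ⊢
    have n1 : B ≠ C := fun h => hBC h.subset
    have n2 : U ≠ B := fun h => hUB h.subset
    have n3 : U ≠ C := fun h => hUC h.subset
    have e3 : U ∪ P = U := Set.union_eq_self_of_subset_right hPU
    have e4 : U ∪ Q = U := Set.union_eq_self_of_subset_right hQU
    have e5 : Q ∪ P = U := by rw [Set.union_comm, hU]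
    have e6 : ∀ T : Set A, T ∪ T = T := Set.union_self
    rcases h with ⟨h3, h4⟩ | ⟨h3, h4⟩ | ⟨h3, h4⟩ | ⟨h3, h4⟩ | ⟨h3, h4⟩ <;>
    rcases h' with ⟨h1, h2⟩ | ⟨h1, h2⟩ | ⟨h1, h2⟩ | ⟨h1, h2⟩ | ⟨h1, h2⟩ <;>
    rw [h1, h3] <;> grind
  · intro h
    have key := h U (by simp) 1 ![(B, B), (C, C)]
      (by intro i; fin_cases i <;> simp)
      (by intro i; fin_cases i
          · exact hBP.trans hPU
          · exact hCQ.trans hQU)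
    have hu : (⋃ i, ((![(B, B), (C, C)] : Fin 2 → Set A × Set A) i).1) = B ∪ C := by
      ext x; simp [Fin.exists_fin_two]
    erw [hu] at key
    simp only [Set.mem_insert_iff, Set.mem_singleton_iff, Prod.mk.injEq] at key
    rcases key with k | ⟨Z, k1, k2, k3⟩
    · grind
    · have := k2.2
      grind
end
end
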